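/- For every a ∈ ℕ, ∫₀^{π/2} sin((2a+1)x)·cos(x)/sin(x) dx = 1 + 2·∑_{μ=1}^{a} (−1)^μ/(1 − 4μ²); consequently |∫₀^{π/2} sin((2a+1)x)·cos(x)/sin(x) dx − π/2| ≤ 2/((2a+1)(2a+3)), so this oscillatory integral equals π/2 + O(a^{−2}) as a → ∞. -/

import Mathlib

open Real MeasureTheory

/-- Product-to-sum expansion of `sin ((2a+1)x) cos x / sin x` as a cosine polynomial. -/
lemma sin_odd_mul_cos_div_sin (a : ℕ) {x : ℝ} (hx : sin x ≠ 0) :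
    sin ((2 * (a : ℝ) + 1) * x) * cos x / sin x =
      cos x + ∑ i ∈ Finset.range a,
        (cos ((2 * (i : ℝ) + 1) * x) + cos ((2 * (i : ℝ) + 3) * x)) := by
  induction a with
  | zero => simp [hx]
  | succ a ih =>
    rw [Finset.sum_range_succ, ← add_assoc, ← ih, div_eq_iff hx, add_mul _ _ (sin x),
      div_mul_cancel₀ _ hx]
    have h₀ : (2 * (a : ℝ) + 1) * x = (2 * (a : ℝ) + 2) * x - x := by ring
    have h₁ : (2 * (a : ℝ) + 3) * x = (2 * (a : ℝ) + 2) * x + x := by ring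
    have h₂ : (2 * ((a + 1 : ℕ) : ℝ) + 1) * x = (2 * (a : ℝ) + 2) * x + x := by push_cast; ring
    rw [h₀, h₁, h₂, sin_add, sin_sub, cos_add, cos_sub]
    ring

lemma integral_cos_mul {c : ℝ} (hc : c ≠ 0) (b : ℝ) :
    ∫ x in (0 : ℝ)..b, cos (c * x) = sin (c * b) / c := by
  rw [intervalIntegral.integral_comp_mul_left (fun x => cos x) hc, integral_cos]
  simp [div_eq_inv_mul]

lemma sin_odd_mul_pi_div_two (n : ℕ) : sin ((2 * (n : ℝ) + 1) * (π / 2)) = (-1) ^ n := by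
  rw [show (2 * (n : ℝ) + 1) * (π / 2) = n * π + π / 2 by ring, sin_add_pi_div_two,
    cos_nat_mul_pi]

lemma integral_sin_odd_mul_cos_div_sin (a : ℕ) :
    ∫ x in Set.Ioo (0 : ℝ) (π / 2), sin ((2 * (a : ℝ) + 1) * x) * cos x / sin x =
      1 + ∑ i ∈ Finset.range a, (-1 : ℝ) ^ i * (2 / ((2 * (i : ℝ) + 1) * (2 * (i : ℝ) + 3))) := by
  have hcongr : Set.EqOn (fun x : ℝ => sin ((2 * (a : ℝ) + 1) * x) * cos x / sin x)
      (fun x => cos x + ∑ i ∈ Finset.range a,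
        (cos ((2 * (i : ℝ) + 1) * x) + cos ((2 * (i : ℝ) + 3) * x)))
      (Set.Ioo (0 : ℝ) (π / 2)) := fun x hx =>
    sin_odd_mul_cos_div_sin a (sin_pos_of_pos_of_lt_pi hx.1 (by linarith [hx.2, pi_pos])).ne'
  have hint (f : ℝ → ℝ) (hf : Continuous f) : IntervalIntegrable f volume 0 (π / 2) :=
    hf.intervalIntegrable _ _
  rw [setIntegral_congr_fun measurableSet_Ioo hcongr, ← integral_Ioc_eq_integral_Ioo,
    ← intervalIntegral.integral_of_le (by positivity),
    intervalIntegral.integral_add (hint _ (by fun_prop)) (hint _ (by fun_prop)),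
    intervalIntegral.integral_finsetSum fun i _ => hint _ (by fun_prop), integral_cos,
    sin_pi_div_two, sin_zero, sub_zero]
  congr 1
  refine Finset.sum_congr rfl fun i _ => ?_
  have h₁ : (2 * (i : ℝ) + 1) ≠ 0 := by positivity
  have h₃ : (2 * (i : ℝ) + 3) ≠ 0 := by positivity
  have hsin : sin ((2 * (i : ℝ) + 3) * (π / 2)) = (-1) ^ (i + 1) := by
    rw [← sin_odd_mul_pi_div_two]
    push_cast
    ring_nf
  rw [intervalIntegral.integral_add (hint _ (by fun_prop)) (hint _ (by fun_prop)),
    integral_cos_mul h₁, integral_cos_mul h₃, sin_odd_mul_pi_div_two, hsin]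
  field_simp
  ring

lemma sum_Icc_neg_one_pow_div (a : ℕ) :
    2 * ∑ μ ∈ Finset.Icc 1 a, (-1 : ℝ) ^ μ / (1 - 4 * (μ : ℝ) ^ 2) =
      ∑ i ∈ Finset.range a, (-1 : ℝ) ^ i * (2 / ((2 * (i : ℝ) + 1) * (2 * (i : ℝ) + 3))) := by
  induction a with
  | zero => simp
  | succ a ih =>
    rw [Finset.sum_Icc_succ_top (by omega), mul_add, ih, Finset.sum_range_succ]
    congr 1
    have h : (1 - 4 * ((a + 1 : ℕ) : ℝ) ^ 2) = -((2 * (a : ℝ) + 1) * (2 * (a : ℝ) + 3)) := by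
      push_cast; ring
    rw [h, pow_succ]
    field_simp

/-- The partial sums in terms of those of the Leibniz series for `π / 4`. -/
lemma one_add_sum_eq_leibniz (a : ℕ) :
    1 + ∑ i ∈ Finset.range a, (-1 : ℝ) ^ i * (2 / ((2 * (i : ℝ) + 1) * (2 * (i : ℝ) + 3))) =
      ∑ i ∈ Finset.range a, (-1 : ℝ) ^ i / (2 * (i : ℝ) + 1) +
        ∑ i ∈ Finset.range (a + 1), (-1 : ℝ) ^ i / (2 * (i : ℝ) + 1) := by
  induction a with
  | zero => simp
  | succ a ih =>
    rw [Finset.sum_range_succ, ← add_assoc, ih, Finset.sum_range_succ _ (a + 1),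
      Finset.sum_range_succ _ a, pow_succ]
    push_cast
    have h : 2 * ((a : ℝ) + 1) + 1 = 2 * a + 3 := by ring
    rw [h]
    field_simp
    ring

/-- The alternating series estimate: the error is at most the first omitted term. -/
lemma abs_alternating_sum_sub_le {b : ℕ → ℝ} {l : ℝ} (hb : Antitone b)
    (hl : Filter.Tendsto (fun n => ∑ i ∈ Finset.range n, (-1 : ℝ) ^ i * b i)
      Filter.atTop (nhds l)) (n : ℕ) :
    |∑ i ∈ Finset.range n, (-1 : ℝ) ^ i * b i - l| ≤ b n := by
  obtain ⟨k, rfl | rfl⟩ := n.even_or_odd'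
  · have h₁ := hb.alternating_series_le_tendsto hl k
    have h₂ := hb.tendsto_le_alternating_series hl k
    rw [Finset.sum_range_succ, pow_mul] at h₂
    norm_num at h₂
    rw [abs_le]
    constructor <;> linarith
  · have h₁ := hb.tendsto_le_alternating_series hl k
    have h₂ := hb.alternating_series_le_tendsto hl (k + 1)
    rw [show 2 * (k + 1) = 2 * k + 1 + 1 by ring, Finset.sum_range_succ, pow_succ, pow_mul] at h₂
    norm_num at h₂
    rw [abs_le]
    constructor <;> linarith

/-- For every `a ∈ ℕ`,
`∫₀^{π/2} sin((2a+1)x)·cos(x)/sin(x) dx = 1 + 2·∑_{μ=1}^{a} (−1)^μ/(1 − 4μ²)`, and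
consequently this oscillatory integral differs from `π/2` by at most
`2/((2a+1)(2a+3))`, i.e. it equals `π/2 + O(a⁻²)` as `a → ∞`. -/
theorem oscillatory_integral_sin_odd_over_tan (a : ℕ) :
    (∫ x in Set.Ioo (0 : ℝ) (Real.pi / 2),
        Real.sin ((2 * (a : ℝ) + 1) * x) * Real.cos x / Real.sin x) =
      1 + 2 * ∑ μ ∈ Finset.Icc 1 a, (-1 : ℝ) ^ μ / (1 - 4 * (μ : ℝ) ^ 2) ∧
    |(∫ x in Set.Ioo (0 : ℝ) (Real.pi / 2),
        Real.sin ((2 * (a : ℝ) + 1) * x) * Real.cos x / Real.sin x) - Real.pi / 2| ≤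
      2 / ((2 * (a : ℝ) + 1) * (2 * (a : ℝ) + 3)) := by
  rw [sum_Icc_neg_one_pow_div, integral_sin_odd_mul_cos_div_sin]
  refine ⟨rfl, ?_⟩
  have hb : Antitone fun i : ℕ => 2 / ((2 * (i : ℝ) + 1) * (2 * (i : ℝ) + 3)) := by
    intro i j hij
    have : (i : ℝ) ≤ j := by exact_mod_cast hij
    dsimp only
    gcongr
  have hl : Filter.Tendsto (fun n => ∑ i ∈ Finset.range n,
      (-1 : ℝ) ^ i * (2 / ((2 * (i : ℝ) + 1) * (2 * (i : ℝ) + 3))))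
      Filter.atTop (nhds (π / 2 - 1)) := by
    have h := tendsto_sum_pi_div_four
    have hsum := (h.add (h.comp (Filter.tendsto_add_atTop_nat 1))).sub_const 1
    rw [show π / 4 + π / 4 - 1 = π / 2 - 1 by ring] at hsum
    refine hsum.congr fun n => ?_
    have := one_add_sum_eq_leibniz n
    simp only [Function.comp_apply]
    linarith
  have h := abs_alternating_sum_sub_le hb hl a
  rwa [show ∀ s : ℝ, s - (π / 2 - 1) = 1 + s - π / 2 by intro s; ring] at h
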